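/- arXiv:1002.4088 — 2 statements merged into one kernel-verified Lean document; each statement's English description precedes it below -/
import Mathlib

section
/- Let q = r^2 be an even power of a prime, let C be an additive code in F_q^n, and let d^⊥ = d(C^⊥tr) be the minimum distance of its trace Hermitian dual. Then every coset of C is an orthogonal array of strength d^⊥ − 1: for every v ∈ F_q^n, every set S of coordinate positions with |S| = t ≤ d^⊥ − 1, and every prescribed tuple w ∈ F_q^S, the number of vectors x ∈ v + C whose restriction to S equals w is exactly |C|/q^t. -/
open scoped Classical

noncomputable section

namespace AQC

/-- Hamming weight of a vector: the number of nonzero entries. -/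
def wt {n : ℕ} {α : Type*} [Zero α] (u : Fin n → α) : ℕ :=
  (Finset.univ.filter (fun i => u i ≠ 0)).card

/-- Minimum distance of a set of words, `ℕ∞`-valued (`⊤` if no nonzero element). -/
def minDistE {n : ℕ} {α : Type*} [Zero α] (S : Set (Fin n → α)) : ℕ∞ :=
  sInf {d | ∃ u ∈ S, u ≠ 0 ∧ (wt u : ℕ∞) = d}

variable (p m n : ℕ) [Fact p.Prime]

instance : Fintype (GaloisField p m) := Fintype.ofFinite _

/-- Words of length `n` over the field `F_q` with `q = p ^ m`. -/
abbrev Word := Fin n → GaloisField p m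

/-- The usual dot product `u · v = ∑ i, u i * v i` on `F_q ^ n`. -/
def dotW (u v : Word p m n) : GaloisField p m := ∑ i, u i * v i

/-- Trace Hermitian dual of a subset of `F_q^n`, `q = r²`, where conjugation is
`x ↦ x ^ r` and `α` is a fixed nonzero element with `α ^ r = -α` (`α = 1` if `p = 2`,
in which case this is `{u | ∀ v ∈ S, ∑ i, (u i * v i ^ r + u i ^ r * v i) = 0}`). -/
def dualTr (r : ℕ) (α : GaloisField p m) (S : Set (Word p m n)) : Set (Word p m n) :=
  {u | ∀ v ∈ S, α * ∑ i, (u i * (v i) ^ r - (u i) ^ r * v i) = 0}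


section Helpers

variable {F : Type*} [Field F] (σ : F →+* F)

/-- The fixed field of `σ`. -/
abbrev fixK : Subfield F := σ.eqLocusField (RingHom.id F)

/-- The one-coordinate trace Hermitian form with values in the fixed field. -/
def formB (hσ : ∀ x, σ (σ x) = x) (α : F) (hα : σ α = -α) :
    F →ₗ[fixK σ] F →ₗ[fixK σ] fixK σ :=
  LinearMap.mk₂ (fixK σ)
    (fun u x => ⟨α * (u * σ x - σ u * x), by
      change σ _ = _
      simp only [map_mul, map_sub, hσ, hα, RingHom.id_apply]
      ring⟩)
    (by intro a b c; ext; simp only [map_add, Subfield.coe_add]; ring)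
    (by
      rintro ⟨k, hk⟩ a b
      change σ k = k at hk
      ext
      simp only [Subfield.smul_def, smul_eq_mul, map_mul, Subfield.coe_mul, hk]; ring)
    (by intro a b c; ext; simp only [map_add, Subfield.coe_add]; ring)
    (by
      rintro ⟨k, hk⟩ a b
      change σ k = k at hk
      ext
      simp only [Subfield.smul_def, smul_eq_mul, map_mul, Subfield.coe_mul, hk]; ring)

theorem formB_apply (hσ : ∀ x, σ (σ x) = x) (α : F) (hα : σ α = -α) (u x : F) :
    (formB σ hσ α hα u x : F) = α * (u * σ x - σ u * x) := rfl

theorem formB_surj [Finite F] (hσ : ∀ x, σ (σ x) = x) (hne : ∃ x, σ x ≠ x)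
    (α : F) (hα0 : α ≠ 0) (hα : σ α = -α) :
    Function.Surjective (formB σ hσ α hα) := by
  have : Module.Finite (fixK σ) F := Module.Finite.of_finite
  have hinj : Function.Injective (formB σ hσ α hα) := by
    rw [injective_iff_map_eq_zero]
    intro u hu
    by_contra hu0
    obtain ⟨x, hx⟩ := hne
    have h : ∀ y, u * σ y = σ u * y := by
      intro y
      have h1 := congrArg (fun k : fixK σ => (k : F)) (LinearMap.congr_fun hu y)
      simp only [formB_apply] at h1
      have h2 : u * σ y - σ u * y = 0 := by
        rcases mul_eq_zero.1 h1 with h | h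
        · exact absurd h hα0
        · exact h
      exact sub_eq_zero.1 h2
    have h1 := h 1
    rw [map_one, mul_one, mul_one] at h1
    have h2 := h x
    rw [← h1] at h2
    exact hx (mul_left_cancel₀ hu0 h2)
  exact (LinearMap.injective_iff_surjective_of_finrank_eq_finrank
    (Subspace.dual_finrank_eq).symm).1 hinj

theorem restr_surj [Finite F] (hσ : ∀ x, σ (σ x) = x) (hne : ∃ x, σ x ≠ x)
    (α : F) (hα0 : α ≠ 0) (hα : σ α = -α) {n : ℕ}
    (C : AddSubgroup (Fin n → F)) (hlin : ∀ x : F, σ x = x → ∀ u ∈ C, x • u ∈ C)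
    (S : Finset (Fin n))
    (hd : ∀ u : Fin n → F, (∀ c ∈ C, α * ∑ i, (u i * σ (c i) - σ (u i) * c i) = 0) →
      (∀ i, i ∉ S → u i = 0) → u = 0)
    (w : S → F) : ∃ c ∈ C, ∀ i : S, c i = w i := by
  let W : Submodule (fixK σ) (S → F) :=
    { carrier := {y | ∃ c ∈ C, ∀ i : S, c i = y i}
      add_mem' := by
        rintro a b ⟨c, hc, h⟩ ⟨c', hc', h'⟩
        exact ⟨c + c', C.add_mem hc hc', fun i => by simp [h, h']⟩
      zero_mem' := ⟨0, C.zero_mem, fun i => rfl⟩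
      smul_mem' := by
        rintro ⟨k, hk⟩ a ⟨c, hc, h⟩
        exact ⟨k • c, hlin k hk c hc, fun i => by simp [h, Subfield.smul_def]⟩ }
  suffices h : W = ⊤ by
    have : w ∈ W := h ▸ Submodule.mem_top
    exact this
  by_contra hW
  obtain ⟨g, hg0, hgW⟩ := Submodule.exists_le_ker_of_lt_top W (lt_top_iff_ne_top.2 hW)
  choose u hu using fun i : S =>
    formB_surj σ hσ hne α hα0 hα (g ∘ₗ LinearMap.single (fixK σ) (fun _ : S => F) i)
  have hgy : ∀ y : S → F, (g y : F) = ∑ i : S, α * (u i * σ (y i) - σ (u i) * y i) := by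
    intro y
    have : y = ∑ i : S, Pi.single i (y i) := (Finset.univ_sum_single y).symm
    conv_lhs => rw [this, map_sum]
    rw [AddSubmonoidClass.coe_finset_sum]
    refine Finset.sum_congr rfl fun i _ => ?_
    rw [← formB_apply σ hσ α hα, hu i]
    rfl
  let U : Fin n → F := fun i => if h : i ∈ S then u ⟨i, h⟩ else 0
  have hU : U = 0 := by
    apply hd
    · intro c hc
      have h0 : g (fun i : S => c i) = 0 := hgW ⟨c, hc, fun i => rfl⟩
      have h1 := hgy (fun i : S => c i)
      rw [h0] at h1
      rw [Finset.mul_sum]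
      rw [← Finset.sum_subset (Finset.subset_univ S) (fun i _ hi => by simp [U, hi]),
        ← Finset.sum_coe_sort]
      refine Eq.trans (Finset.sum_congr rfl fun i _ => ?_) h1.symm
      simp [U]
    · intro i hi
      simp [U, hi]
  apply hg0
  refine LinearMap.ext fun y => Subtype.ext ?_
  rw [hgy y]
  have : ∀ i : S, u i = 0 := by
    intro i
    have := congrFun hU i
    simpa [U] using this
  simp [this]

theorem count_fibre [Fintype F] {n : ℕ} (C : AddSubgroup (Fin n → F)) (S : Finset (Fin n))
    (hs : ∀ w : S → F, ∃ c ∈ C, ∀ i : S, c i = w i) (v : Fin n → F) (w : S → F) :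
    (Finset.univ.filter (fun x : Fin n → F =>
        (∃ c ∈ C, x = v + c) ∧ ∀ i, ∀ h : i ∈ S, x i = w ⟨i, h⟩)).card
      * (Nat.card F) ^ S.card = Nat.card C := by
  let φ : C →+ (S → F) :=
    { toFun := fun c i => (c : Fin n → F) i
      map_zero' := rfl
      map_add' := fun _ _ => rfl }
  have hφ : Function.Surjective φ := by
    intro w
    obtain ⟨c, hc, h⟩ := hs w
    exact ⟨⟨c, hc⟩, funext h⟩
  have h1 : Nat.card C = Nat.card (S → F) * Nat.card φ.ker := by
    rw [AddSubgroup.card_eq_card_quotient_mul_card_addSubgroup φ.ker,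
      Nat.card_congr (QuotientAddGroup.quotientKerEquivOfSurjective φ hφ).toEquiv]
  have h2 : Nat.card (S → F) = Nat.card F ^ S.card := by
    simp [Nat.card_fun]
  rw [h1, h2, mul_comm]
  congr 1
  obtain ⟨c0, hc0, h0⟩ := hs (fun i => w i - v i)
  rw [Nat.card_eq_fintype_card, ← Finset.card_univ]
  symm
  refine Finset.card_bij (fun k _ => v + c0 + ((k : C) : Fin n → F)) ?_ ?_ ?_
  · intro k _
    refine Finset.mem_filter.2 ⟨Finset.mem_univ _, ⟨c0 + ((k : C) : Fin n → F),
      C.add_mem hc0 k.1.2, add_assoc _ _ _⟩, ?_⟩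
    intro i hi
    have hk : ((k : C) : Fin n → F) i = 0 := congrFun k.2 ⟨i, hi⟩
    have := h0 ⟨i, hi⟩
    simp only at this
    simp [hk, this]
  · intro a _ b _ h
    exact Subtype.ext (Subtype.ext (add_left_cancel h))
  · intro x hx
    obtain ⟨_, ⟨c, hc, rfl⟩, hxw⟩ := Finset.mem_filter.1 hx
    refine ⟨⟨⟨c - c0, C.sub_mem hc hc0⟩, ?_⟩, Finset.mem_univ _, ?_⟩
    · rw [AddMonoidHom.mem_ker]
      funext i
      change c i - c0 i = 0
      rw [h0 i, ← hxw i i.2]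
      simp
    · simp only
      abel

end Helpers

/-- every coset of an additive code `C ⊆ F_q^n`, `q = r² = p^{2f}`,
is an orthogonal array of strength `d(C^⊥tr) - 1`: for `t ≤ d(C^⊥tr) - 1`, the number
of vectors of `v + C` agreeing with a prescribed tuple `w` on a set `S` of `t`
coordinates is exactly `|C| / q^t`. -/
theorem statement1 (p f n : ℕ) [Fact p.Prime] (hf : f ≠ 0)
    (α : GaloisField p (2 * f)) (hα0 : α ≠ 0) (hαr : α ^ p ^ f = -α)
    (hα1 : p = 2 → α = 1)
    (C : AddSubgroup (Word p (2 * f) n))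
    (hlin : ∀ x : GaloisField p (2 * f), x ^ p ^ f = x → ∀ u ∈ C, x • u ∈ C)
    (t : ℕ) (ht : (t : ℕ∞) ≤ minDistE (dualTr p (2 * f) n (p ^ f) α (C : Set (Word p (2 * f) n))) - 1)
    (v : Word p (2 * f) n) (S : Finset (Fin n)) (hS : S.card = t)
    (w : {i // i ∈ S} → GaloisField p (2 * f)) :
    (Finset.univ.filter (fun x : Word p (2 * f) n =>
        (∃ c ∈ C, x = v + c) ∧ ∀ i, ∀ h : i ∈ S, x i = w ⟨i, h⟩)).card
      * (p ^ (2 * f)) ^ t = Nat.card C := by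
  have hq : Nat.card (GaloisField p (2 * f)) = p ^ (2 * f) := GaloisField.card p _ (by omega)
  have hp : p.Prime := Fact.out
  let σ : GaloisField p (2 * f) →+* GaloisField p (2 * f) := iterateFrobenius _ p f
  have hσd : ∀ x, σ x = x ^ p ^ f := fun x => iterateFrobenius_def ..
  have hσ : ∀ x, σ (σ x) = x := by
    intro x
    rw [hσd, hσd, ← pow_mul, ← pow_add, ← two_mul, ← hq, Nat.card_eq_fintype_card,
      FiniteField.pow_card]
  have hne : ∃ x, σ x ≠ x := by
    by_contra! h
    have h1 : 1 < p ^ f := Nat.one_lt_pow hf hp.one_lt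
    have hX := FiniteField.X_pow_card_sub_X_ne_zero (GaloisField p (2 * f)) h1
    have hc := Polynomial.card_le_degree_of_subset_roots
      (p := (Polynomial.X ^ (p ^ f) - Polynomial.X : Polynomial (GaloisField p (2 * f))))
      (Z := Finset.univ) (by
        intro x _
        rw [Polynomial.mem_roots hX]
        simp [← hσd, h])
    rw [FiniteField.X_pow_card_sub_X_natDegree_eq _ h1, Finset.card_univ,
      ← Nat.card_eq_fintype_card, hq] at hc
    have := Nat.pow_lt_pow_right hp.one_lt (show f < 2 * f by omega)
    omega
  have hs := restr_surj σ hσ hne α hα0 (by rw [hσd, hαr]) C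
    (fun x hx => hlin x (by rw [← hσd, hx])) S (by
      intro u hu huS
      by_contra hu0
      have hmem : u ∈ dualTr p (2 * f) n (p ^ f) α (C : Set (Word p (2 * f) n)) := by
        intro c hc
        simpa only [hσd] using hu c hc
      have h1 : minDistE (dualTr p (2 * f) n (p ^ f) α (C : Set (Word p (2 * f) n))) ≤ (t : ℕ∞) := by
        refine le_trans (sInf_le ⟨u, hmem, hu0, rfl⟩) ?_
        rw [← hS]
        refine Nat.cast_le.2 (Finset.card_le_card ?_)
        intro i hi
        by_contra hiS
        exact (Finset.mem_filter.1 hi).2 (huS i hiS)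
      have h2 : 1 ≤ minDistE (dualTr p (2 * f) n (p ^ f) α (C : Set (Word p (2 * f) n))) := by
        refine le_sInf ?_
        rintro d ⟨x, _, hx0, rfl⟩
        obtain ⟨i, hi⟩ := Function.ne_iff.1 hx0
        have : 0 < wt x := Finset.card_pos.2 ⟨i, Finset.mem_filter.2 ⟨Finset.mem_univ _, hi⟩⟩
        exact_mod_cast this
      generalize minDistE (dualTr p (2 * f) n (p ^ f) α (C : Set (Word p (2 * f) n))) = d at *
      have hdt : d ≠ ⊤ := ne_top_of_le_ne_top (ENat.coe_ne_top t) h1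
      lift d to ℕ using hdt
      norm_cast at h1 h2 ht
      omega)
  have := count_fibre C S hs v w
  rw [hq, hS] at this
  convert this
end AQC
end
end

section
/- Let q be a prime power and let n, K, a, b be positive integers. There exists an asymmetric quantum code Q with parameters ((n,K,a/b))_q if and only if there exists an asymmetric quantum code Q' with parameters ((n,K,b/a))_q; moreover, Q' can be chosen pure if and only if Q can be chosen pure. -/
open scoped Classical

noncomputable section

namespace AQC

variable (p m n : ℕ) [Fact p.Prime]

/-- The state space `V_n = ℂ^(F_q^n)`. -/
abbrev QV := Word p m n → ℂ

/-- The trace map `T : F_q → F_p`. -/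
def gfTr (x : GaloisField p m) : ZMod p := Algebra.trace (ZMod p) (GaloisField p m) x

/-- `η = exp(2πi/p)`, a primitive `p`-th root of unity. -/
def eta : ℂ := Complex.exp (2 * Real.pi * Complex.I / p)

/-- The additive character `x ↦ η ^ x` of `F_p`. -/
def chi (x : ZMod p) : ℂ := eta p ^ x.val

/-- The Hermitian inner product `⟨u|v⟩ = ∑ c, conj (u c) * v c` on the state space. -/
def hInner (u v : QV p m n) : ℂ := ∑ c, (starRingEnd ℂ) (u c) * v c

/-- The error operator `e = X(a)Z(b)`, acting by `e|c⟩ = η^{T(b·c)} |a+c⟩`. -/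
def errOp (a b : Word p m n) : QV p m n →ₗ[ℂ] QV p m n where
  toFun f := fun x => chi p (gfTr p m (dotW p m n b (x - a))) * f (x - a)
  map_add' f g := by funext x; simp [mul_add]
  map_smul' c f := by funext x; simp; ring

/-- Purity of an asymmetric quantum code with parameters `((n,K,d_z/d_x))_q`. -/
def IsPureAQEC (Q : Submodule ℂ (QV p m n)) (dz dx : ℕ) : Prop :=
  ∀ u ∈ Q, ∀ v ∈ Q, ∀ a b : Word p m n,
    1 ≤ wt a → wt a ≤ dx - 1 → 1 ≤ wt b → wt b ≤ dz - 1 →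
      hInner p m n u (errOp p m n a b v) = 0

/-- `Q` is an asymmetric quantum code with parameters `((n,K,d_z/d_x))_q`:
a `K`-dimensional subspace of `V_n` detecting `d_x - 1` qudits of `X`-errors and
`d_z - 1` qudits of `Z`-errors; a code with `K = 1` is required to be pure. -/
def IsAQEC (Q : Submodule ℂ (QV p m n)) (K dz dx : ℕ) : Prop :=
  Module.finrank ℂ Q = K ∧ 1 ≤ K ∧
  (∀ u ∈ Q, ∀ v ∈ Q, hInner p m n u v = 0 →
    ∀ a b : Word p m n, wt a ≤ dx - 1 → wt b ≤ dz - 1 →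
      hInner p m n u (errOp p m n a b v) = 0) ∧
  (K = 1 → IsPureAQEC p m n Q dz dx)



/-! ### Fourier transform -/

lemma eta_pow : eta p ^ p = 1 := by
  have hp : (p : ℂ) ≠ 0 := by exact_mod_cast (Fact.out : p.Prime).ne_zero
  unfold eta
  rw [← Complex.exp_nat_mul, mul_div_cancel₀ _ hp, Complex.exp_two_pi_mul_I]

lemma chi_add (x y : ZMod p) : chi p (x + y) = chi p x * chi p y := by
  unfold chi
  rw [ZMod.val_add, ← pow_add]
  exact (pow_eq_pow_mod _ (eta_pow p)).symm

lemma chi_zero : chi p 0 = 1 := by simp [chi]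

lemma chi_norm (x : ZMod p) : ‖chi p x‖ = 1 := by
  have h : ‖eta p‖ = 1 :=
    Complex.norm_eq_one_of_pow_eq_one (eta_pow p) (Fact.out : p.Prime).ne_zero
  simp [chi, h]

lemma chi_ne_zero (x : ZMod p) : chi p x ≠ 0 := by
  intro h
  have := chi_norm p x
  simp [h] at this

lemma chi_conj (x : ZMod p) : (starRingEnd ℂ) (chi p x) = chi p (-x) := by
  have h1 : chi p x * chi p (-x) = 1 := by rw [← chi_add, add_neg_cancel, chi_zero]
  have h2 : chi p x * (starRingEnd ℂ) (chi p x) = 1 := by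
    rw [Complex.mul_conj, Complex.normSq_eq_norm_sq, chi_norm]; simp
  exact mul_left_cancel₀ (chi_ne_zero p x) (h2.trans h1.symm)

lemma chi_one_ne : chi p 1 ≠ 1 := by
  have hp := (Fact.out : p.Prime)
  haveI : Fact (1 < p) := ⟨hp.one_lt⟩
  have := (Complex.isPrimitiveRoot_exp p hp.ne_zero).ne_one hp.one_lt
  simpa [chi, eta, ZMod.val_one] using this

/-- The pairing character. -/
def pairE (y c : Word p m n) : ℂ := chi p (gfTr p m (dotW p m n y c))

lemma pairE_comm (y c : Word p m n) : pairE p m n y c = pairE p m n c y := by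
  unfold pairE dotW
  simp only [mul_comm]

lemma pairE_add_left (y z c : Word p m n) :
    pairE p m n (y + z) c = pairE p m n y c * pairE p m n z c := by
  unfold pairE
  rw [← chi_add]
  congr 1
  simp [gfTr, dotW, add_mul, Finset.sum_add_distrib]

lemma pairE_add_right (y c d : Word p m n) :
    pairE p m n y (c + d) = pairE p m n y c * pairE p m n y d := by
  rw [pairE_comm, pairE_add_left, pairE_comm p m n c, pairE_comm p m n d]

lemma pairE_conj (y c : Word p m n) :
    (starRingEnd ℂ) (pairE p m n y c) = pairE p m n y (-c) := by
  unfold pairE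
  rw [chi_conj]
  congr 1
  simp [gfTr, dotW]

lemma pairE_zero_right (y : Word p m n) : pairE p m n y 0 = 1 := by
  simp [pairE, gfTr, dotW, chi_zero]

lemma pairE_ne_zero (y c : Word p m n) : pairE p m n y c ≠ 0 := chi_ne_zero _ _

lemma exists_pairE_ne (d : Word p m n) (hd : d ≠ 0) : ∃ y, pairE p m n y d ≠ 1 := by
  obtain ⟨i, hi⟩ := Function.ne_iff.mp hd
  obtain ⟨x, hx⟩ := Algebra.trace_surjective (ZMod p) (GaloisField p m) 1
  refine ⟨Pi.single i (x / d i), ?_⟩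
  have h : dotW p m n (Pi.single i (x / d i)) d = x := by
    unfold dotW
    rw [Finset.sum_eq_single i]
    · simp only [Pi.single_eq_same]; exact div_mul_cancel₀ x hi
    · intro j _ hj; simp [Pi.single_eq_of_ne hj]
    · simp
  unfold pairE
  rw [h, gfTr, hx]
  exact chi_one_ne p

lemma sum_pairE (d : Word p m n) :
    ∑ y, pairE p m n y d = if d = 0 then (Fintype.card (Word p m n) : ℂ) else 0 := by
  split_ifs with h
  · subst h; simp [pairE_zero_right]
  · obtain ⟨z, hz⟩ := exists_pairE_ne p m n d h
    have h1 : ∑ y, pairE p m n y d = pairE p m n z d * ∑ y, pairE p m n y d := by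
      rw [Finset.mul_sum]
      simp only [← pairE_add_left]
      exact (Equiv.sum_comp (Equiv.addLeft z) (fun y => pairE p m n y d)).symm
    have h2 : (pairE p m n z d - 1) * ∑ y, pairE p m n y d = 0 := by
      rw [sub_mul, ← h1]; ring
    exact (mul_eq_zero.mp h2).resolve_left (sub_ne_zero.mpr hz)

/-- The (unnormalised) Fourier transform. -/
def four : QV p m n →ₗ[ℂ] QV p m n where
  toFun f := fun y => ∑ c, pairE p m n y c * f c
  map_add' f g := by funext y; simp [mul_add, Finset.sum_add_distrib]
  map_smul' r f := by
    funext y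
    simp only [Pi.smul_apply, smul_eq_mul, RingHom.id_apply, Finset.mul_sum]
    exact Finset.sum_congr rfl fun c _ => by ring

lemma four_apply (f : QV p m n) (y : Word p m n) :
    four p m n f y = ∑ c, pairE p m n y c * f c := rfl

lemma errOp_apply (a b x : Word p m n) (f : QV p m n) :
    errOp p m n a b f x = pairE p m n b (x - a) * f (x - a) := rfl

lemma parseval (u v : QV p m n) :
    hInner p m n (four p m n u) (four p m n v)
      = (Fintype.card (Word p m n) : ℂ) * hInner p m n u v := by
  have key : ∀ c d : Word p m n,
      ∑ y, (starRingEnd ℂ) (pairE p m n y c * u c) * (pairE p m n y d * v d)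
        = if d = c then (Fintype.card (Word p m n) : ℂ) * ((starRingEnd ℂ) (u c) * v d)
          else 0 := by
    intro c d
    have h1 : ∀ y, (starRingEnd ℂ) (pairE p m n y c * u c) * (pairE p m n y d * v d)
        = pairE p m n y (-c + d) * ((starRingEnd ℂ) (u c) * v d) := by
      intro y
      rw [map_mul, pairE_conj, pairE_add_right]; ring
    simp only [h1]
    rw [← Finset.sum_mul, sum_pairE]
    have h2 : -c + d = 0 ↔ d = c := by rw [neg_add_eq_zero, eq_comm]
    simp only [h2]
    split_ifs <;> simp
  unfold hInner
  simp only [four_apply, map_sum, Finset.sum_mul_sum]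
  rw [Finset.sum_comm, Finset.mul_sum]
  refine Finset.sum_congr rfl fun c _ => ?_
  rw [Finset.sum_comm]
  simp only [key]
  simp

lemma card_ne : (Fintype.card (Word p m n) : ℂ) ≠ 0 := by
  exact_mod_cast Fintype.card_ne_zero

lemma four_inj : Function.Injective (four p m n) := by
  rw [injective_iff_map_eq_zero]
  intro f hf
  have h := parseval p m n f f
  rw [hf] at h
  have h0 : hInner p m n f f = 0 := by
    have h' : (Fintype.card (Word p m n) : ℂ) * hInner p m n f f = 0 := by
      rw [← h]; simp [hInner]
    exact (mul_eq_zero.mp h').resolve_left (card_ne p m n)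
  have h1 : ∑ c, Complex.normSq (f c) = 0 := by
    have : ((∑ c, Complex.normSq (f c) : ℝ) : ℂ) = 0 := by
      rw [← h0]
      unfold hInner
      push_cast
      exact Finset.sum_congr rfl fun c _ => Complex.normSq_eq_conj_mul_self
    exact_mod_cast this
  rw [Finset.sum_eq_zero_iff_of_nonneg (fun c _ => Complex.normSq_nonneg _)] at h1
  funext c
  exact Complex.normSq_eq_zero.mp (h1 c (Finset.mem_univ c))

lemma four_errOp (a b : Word p m n) (f : QV p m n) :
    errOp p m n a b (four p m n f)
      = pairE p m n b (-a) • four p m n (errOp p m n b (-a) f) := by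
  funext y
  rw [errOp_apply, Pi.smul_apply, smul_eq_mul, four_apply, four_apply]
  have h : ∑ c, pairE p m n y c * errOp p m n b (-a) f c
      = ∑ c, pairE p m n y (c + b) * (pairE p m n (-a) c * f c) := by
    rw [← Equiv.sum_comp (Equiv.addRight b)]
    refine Finset.sum_congr rfl fun c _ => ?_
    simp only [Equiv.coe_addRight, errOp_apply, add_sub_cancel_right]
  rw [h, Finset.mul_sum, Finset.mul_sum]
  refine Finset.sum_congr rfl fun c _ => ?_
  rw [sub_eq_add_neg, pairE_add_right, pairE_add_left, pairE_add_right, pairE_comm p m n b y]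
  ring

lemma hInner_four (a b : Word p m n) (u v : QV p m n) 
    (h : hInner p m n u (errOp p m n b (-a) v) = 0) :
    hInner p m n (four p m n u) (errOp p m n a b (four p m n v)) = 0 := by
  rw [four_errOp]
  have h1 : ∀ (r : ℂ) (x y : QV p m n), hInner p m n x (r • y) = r * hInner p m n x y := by
    intro r x y
    simp only [hInner, Pi.smul_apply, smul_eq_mul, Finset.mul_sum]
    exact Finset.sum_congr rfl fun c _ => by ring
  rw [h1, parseval, h]; simp

lemma wt_neg (a : Word p m n) : wt (-a) = wt a := by simp [wt]

lemma pure_four (Q : Submodule ℂ (QV p m n)) (dz dx : ℕ) (h : IsPureAQEC p m n Q dz dx) :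
    IsPureAQEC p m n (Q.map (four p m n)) dx dz := by
  rintro _ ⟨u, hu, rfl⟩ _ ⟨v, hv, rfl⟩ a b h1 h2 h3 h4
  apply hInner_four
  apply h u hu v hv <;> simpa only [wt_neg]

lemma aqec_four (Q : Submodule ℂ (QV p m n)) (K dz dx : ℕ) (h : IsAQEC p m n Q K dz dx) :
    IsAQEC p m n (Q.map (four p m n)) K dx dz := by
  obtain ⟨h1, h2, h3, h4⟩ := h
  refine ⟨?_, h2, ?_, fun hk => pure_four p m n Q dz dx (h4 hk)⟩
  · rw [← h1]
    exact (Submodule.equivMapOfInjective _ (four_inj p m n) Q).finrank_eq.symm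
  · rintro _ ⟨u, hu, rfl⟩ _ ⟨v, hv, rfl⟩ huv a b ha hb
    apply hInner_four
    rw [parseval] at huv
    have huv' := (mul_eq_zero.mp huv).resolve_left (card_ne p m n)
    apply h3 u hu v hv huv' <;> simpa only [wt_neg]

/-- Proposition 3.2, Feng--Wang: an asymmetric quantum code
`((n,K,a/b))_q` exists iff one with parameters `((n,K,b/a))_q` exists, and the same
holds for pure codes. -/
theorem statement5 (p m n K a b : ℕ) [Fact p.Prime] (hm : m ≠ 0) (hn : 0 < n)
    (hK : 0 < K) (ha : 0 < a) (hb : 0 < b) :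
    ((∃ Q : Submodule ℂ (QV p m n), IsAQEC p m n Q K a b) ↔
      (∃ Q' : Submodule ℂ (QV p m n), IsAQEC p m n Q' K b a)) ∧
    ((∃ Q : Submodule ℂ (QV p m n), IsAQEC p m n Q K a b ∧ IsPureAQEC p m n Q a b) ↔
      (∃ Q' : Submodule ℂ (QV p m n), IsAQEC p m n Q' K b a ∧ IsPureAQEC p m n Q' b a)) := by
  refine ⟨⟨?_, ?_⟩, ⟨?_, ?_⟩⟩
  · rintro ⟨Q, h⟩; exact ⟨_, aqec_four p m n Q K a b h⟩
  · rintro ⟨Q, h⟩; exact ⟨_, aqec_four p m n Q K b a h⟩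
  · rintro ⟨Q, h, h'⟩; exact ⟨_, aqec_four p m n Q K a b h, pure_four p m n Q a b h'⟩
  · rintro ⟨Q, h, h'⟩; exact ⟨_, aqec_four p m n Q K b a h, pure_four p m n Q b a h'⟩
end AQC
end
end
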